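/- arXiv:math/0404115 — 7 statements merged into one kernel-verified Lean document; each statement's English description precedes it below -/
import Mathlib

section
/- Let G be a finitely generated amenable group equipped with the word metric, and let H be a proper subgroup of G of finite index n > 1. Then the inclusion map i : H → G is not a bounded distance from a bijection; that is, there is no bijection b : H → G such that sup_{h ∈ H} d(h, b(h)) < ∞ (distances measured in the word metric of G). -/
open Filter

/-- The word length of `g` with respect to a generating set `S`: the least `n` such that `g`
is a product of `n` elements of `S ∪ S⁻¹`. -/
noncomputable def wordLength {G : Type*} [Group G] (S : Set G) (g : G) : ℕ :=
  sInf {n : ℕ | ∃ w : List G, w.length = n ∧ (∀ x ∈ w, x ∈ S ∨ x⁻¹ ∈ S) ∧ w.prod = g}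

/-- The word metric `d(x,y) = ‖x⁻¹y‖` with respect to the generating set `S`. -/
noncomputable def wordDist {G : Type*} [Group G] (S : Set G) (x y : G) : ℝ :=
  (wordLength S (x⁻¹ * y) : ℝ)

/-- Distance from a point to a set in the word metric. -/
noncomputable def setDist {G : Type*} [Group G] (S : Set G) (x : G) (A : Set G) : ℝ :=
  sInf ((fun a => wordDist S x a) '' A)

/-- The boundary `∂A = {x ∈ G : 0 < d(x,A) ≤ 1}`. -/
def wordBoundary {G : Type*} [Group G] (S : Set G) (A : Set G) : Set G :=
  {x : G | 0 < setDist S x A ∧ setDist S x A ≤ 1}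

/-- A Folner sequence: nonempty finite subsets `F i` with `|∂F i| / |F i| → 0`. -/
def IsFolner {G : Type*} [Group G] (S : Set G) (F : ℕ → Finset G) : Prop :=
  (∀ i, (F i).Nonempty) ∧
  Filter.Tendsto
    (fun i => ((wordBoundary S ((F i : Set G))).ncard : ℝ) / ((F i).card : ℝ))
    Filter.atTop (nhds 0)

/-- A `(K,C)` quasi-isometry between spaces with distance functions `dX`, `dY`:
`-C + dX x x' / K ≤ dY (f x) (f x') ≤ K * dX x x' + C`, and the image is `C`-dense. -/
def IsQuasiIsometry {X Y : Type*} (dX : X → X → ℝ) (dY : Y → Y → ℝ) (f : X → Y) : Prop :=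
  ∃ K C : ℝ, 1 ≤ K ∧ 0 ≤ C ∧
    (∀ x x' : X, -C + dX x x' / K ≤ dY (f x) (f x') ∧ dY (f x) (f x') ≤ K * dX x x' + C) ∧
    (∀ y : Y, ∃ x : X, dY (f x) y ≤ C)

theorem wl_spec {G : Type*} [Group G] (S : Set G) (hSgen : Subgroup.closure S = ⊤) (g : G) :
    ∃ w : List G, w.length = wordLength S g ∧ (∀ x ∈ w, x ∈ S ∨ x⁻¹ ∈ S) ∧ w.prod = g := by
  have h : {n : ℕ | ∃ w : List G, w.length = n ∧ (∀ x ∈ w, x ∈ S ∨ x⁻¹ ∈ S) ∧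
      w.prod = g}.Nonempty := by
    have hg : g ∈ Subgroup.closure S := by rw [hSgen]; trivial
    rw [← Subgroup.mem_toSubmonoid, Subgroup.closure_toSubmonoid] at hg
    obtain ⟨l, hl, hp⟩ := Submonoid.exists_list_of_mem_closure hg
    exact ⟨l.length, l, rfl, fun x hx => by simpa using hl x hx, hp⟩
  exact Nat.sInf_mem h

theorem ball_finite {G : Type*} [Group G] (S : Set G) (hSfin : S.Finite)
    (hSgen : Subgroup.closure S = ⊤) (N : ℕ) : {g : G | wordLength S g ≤ N}.Finite := by
  have hT : (S ∪ S⁻¹).Finite := hSfin.union hSfin.inv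
  have := hT.to_subtype
  have hf := List.finite_length_le (↥(S ∪ S⁻¹)) N
  refine (hf.image (fun l => (l.map Subtype.val).prod)).subset ?_
  intro g hg
  obtain ⟨w, hw, hS, hp⟩ := wl_spec S hSgen g
  have hS' : ∀ x ∈ w, x ∈ S ∪ S⁻¹ := fun x hx => by simpa using hS x hx
  lift w to List ↥(S ∪ S⁻¹) using hS'
  refine ⟨w, ?_, hp⟩
  simp only [List.length_map] at hw
  simp only [Set.mem_ofPred_eq] at hg ⊢
  omega

theorem wl_pos {G : Type*} [Group G] (S : Set G) (hSgen : Subgroup.closure S = ⊤) (g : G)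
    (hg : g ≠ 1) : 1 ≤ wordLength S g := by
  obtain ⟨w, hw, -, hp⟩ := wl_spec S hSgen g
  rcases w with _ | ⟨a, w⟩
  · simp at hp; exact absurd hp.symm hg
  · simp at hw; omega

theorem bdry_finite {G : Type*} [Group G] (S : Set G) (hSfin : S.Finite)
    (hSgen : Subgroup.closure S = ⊤) (F : Finset G) (hF : F.Nonempty) :
    (wordBoundary S (F : Set G)).Finite := by
  have hB := ball_finite S hSfin hSgen 1
  refine (Set.Finite.image2 (fun a g => a * g⁻¹) F.finite_toSet hB).subset ?_
  intro x hx
  have hne : ((fun a => wordDist S x a) '' (F : Set G)).Nonempty := by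
    simpa using hF
  obtain ⟨a, ha, hax⟩ := hne.csInf_mem (F.finite_toSet.image _)
  refine ⟨a, ha, x⁻¹ * a, ?_, by simp⟩
  have h2 : setDist S x F ≤ 1 := hx.2
  unfold setDist at h2
  rw [← hax] at h2
  simp only [wordDist] at h2
  exact_mod_cast h2

open Classical in
/-- The number of points moved out of `F` by right multiplication by `k`. -/
noncomputable def moved {G : Type*} [Group G] (F : Finset G) (k : G) : ℕ :=
  (F.image (fun x => x * k) \ F).card

theorem moved_gen {G : Type*} [Group G] (S : Set G) (hSfin : S.Finite)
    (hSgen : Subgroup.closure S = ⊤) (F : Finset G) (hF : F.Nonempty) (s : G) (hs : s ∈ S) :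
    moved F s ≤ (wordBoundary S (F : Set G)).ncard := by
  classical
  unfold moved
  rw [← Set.ncard_coe_finset]
  refine Set.ncard_le_ncard ?_ (bdry_finite S hSfin hSgen F hF)
  intro x hx
  simp only [Finset.coe_sdiff, Set.mem_sdiff, Finset.mem_coe, Finset.mem_image] at hx
  obtain ⟨⟨f, hf, rfl⟩, hx⟩ := hx
  have h1 : (1 : ℝ) ≤ setDist S (f * s) F := by
    unfold setDist
    refine le_csInf (by simpa using hF) ?_
    rintro _ ⟨a, ha, rfl⟩
    have : 1 ≤ wordLength S ((f * s)⁻¹ * a) := by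
      apply wl_pos S hSgen
      intro h
      rw [inv_mul_eq_one] at h
      exact hx (h ▸ ha)
    simp only [wordDist]
    exact_mod_cast this
  refine ⟨by linarith, ?_⟩
  have h2 : setDist S (f * s) F ≤ wordDist S (f * s) f := by
    unfold setDist
    exact csInf_le (F.finite_toSet.image _).bddBelow ⟨f, hf, rfl⟩
  refine h2.trans ?_
  have : wordLength S ((f * s)⁻¹ * f) ≤ 1 := by
    apply Nat.sInf_le
    exact ⟨[s⁻¹], by simp, by simp [hs], by simp⟩
  simp only [wordDist]
  exact_mod_cast this

theorem moved_mul {G : Type*} [Group G] (F : Finset G) (k l : G) :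
    moved F (k * l) ≤ moved F k + moved F l := by
  classical
  unfold moved
  calc _ ≤ ((F.image (fun x => x * k) \ F).image (fun x => x * l) ∪
      (F.image (fun x => x * l) \ F)).card := by
        apply Finset.card_le_card
        intro x hx
        simp only [Finset.mem_sdiff, Finset.mem_image, Finset.mem_union] at hx ⊢
        obtain ⟨⟨f, hf, rfl⟩, hx⟩ := hx
        by_cases h : f * k ∈ F
        · exact Or.inr ⟨⟨_, h, by group⟩, hx⟩
        · exact Or.inl ⟨_, ⟨⟨f, hf, rfl⟩, h⟩, by group⟩
    _ ≤ _ := (Finset.card_union_le _ _).trans (Nat.add_le_add_right Finset.card_image_le _)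

theorem moved_inv {G : Type*} [Group G] (F : Finset G) (k : G) :
    moved F k⁻¹ ≤ moved F k := by
  classical
  have h1 : moved F k⁻¹ ≤ (F \ F.image (fun x => x * k)).card := by
    unfold moved
    refine Finset.card_le_card_of_injOn (fun x => x * k) ?_ (mul_left_injective k).injOn
    intro x hx
    simp only [Finset.coe_sdiff, Set.mem_sdiff, Finset.mem_coe, Finset.mem_image] at hx ⊢
    obtain ⟨⟨f, hf, rfl⟩, hx⟩ := hx
    refine ⟨by simpa using hf, ?_⟩
    rintro ⟨g, hg, h⟩
    exact hx (mul_right_cancel h ▸ hg)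
  refine h1.trans (le_of_eq ?_)
  unfold moved
  apply Finset.card_sdiff_comm
  rw [Finset.card_image_of_injective _ (mul_left_injective k)]

theorem moved_tendsto {G : Type*} [Group G] (S : Set G) (hSfin : S.Finite)
    (hSgen : Subgroup.closure S = ⊤) (F : ℕ → Finset G) (hF : IsFolner S F) (k : G) :
    Filter.Tendsto (fun i => (moved (F i) k : ℝ) / ((F i).card : ℝ)) Filter.atTop (nhds 0) := by
  have hk : k ∈ Subgroup.closure S := by rw [hSgen]; trivial
  induction hk using Subgroup.closure_induction with
  | mem s hs =>
    refine squeeze_zero (fun i => by positivity) (fun i => ?_) hF.2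
    have := moved_gen S hSfin hSgen (F i) (hF.1 i) s hs
    gcongr
  | one => classical simp [moved, Finset.sdiff_self]
  | mul x y _ _ hx hy =>
    refine squeeze_zero (fun i => by positivity) (fun i => ?_) (by simpa using hx.add hy)
    rw [← add_div]
    have := moved_mul (F i) x y
    gcongr
    exact_mod_cast this
  | inv x _ hx =>
    refine squeeze_zero (fun i => by positivity) (fun i => ?_) hx
    have := moved_inv (F i) x
    gcongr

theorem key_count {G : Type*} [Group G] (F B : Finset G) (H : Subgroup G) (t : G) (ht : t ∉ H)
    (b : H → G) (hb : Function.Bijective b) (hB : ∀ h : H, (b h)⁻¹ * (h : G) ∈ B) :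
    F.card ≤ 2 * ∑ k ∈ B, moved F k + moved F t := by
  classical
  set A := F.filter (fun x => x ∈ H) with hA
  have h1 : F.card ≤ A.card + ∑ k ∈ B, moved F k := by
    obtain ⟨c, hc1, hc2⟩ := Function.bijective_iff_has_inverse.1 hb
    have : F.card ≤ (A ∪ B.biUnion (fun k => F.image (fun x => x * k) \ F)).card := by
      refine Finset.card_le_card_of_injOn (fun x => (c x : G)) ?_ ?_
      · intro x hx
        simp only [Finset.mem_coe] at hx
        have hBx := hB (c x)
        rw [hc2 x] at hBx
        simp only [Finset.mem_coe, Finset.mem_union, hA, Finset.mem_filter, Finset.mem_biUnion,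
          Finset.mem_sdiff, Finset.mem_image]
        by_cases h : (c x : G) ∈ F
        · exact Or.inl ⟨h, (c x).2⟩
        · exact Or.inr ⟨_, hBx, ⟨x, hx, by group⟩, h⟩
      · intro x _ y _ h
        exact hc2.injective (Subtype.ext h)
    exact this.trans ((Finset.card_union_le _ _).trans
      (Nat.add_le_add_left Finset.card_biUnion_le _))
  have h2 : A.card ≤ (F \ A).card + moved F t := by
    refine le_trans ?_ (Finset.card_union_le _ _)
    refine Finset.card_le_card_of_injOn (fun x => x * t) ?_ (mul_left_injective t).injOn
    intro x hx
    simp only [hA, Finset.coe_filter, Set.mem_ofPred_eq] at hx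
    simp only [Finset.mem_coe, Finset.mem_union, hA, Finset.mem_filter,
          Finset.mem_sdiff, Finset.mem_image]
    by_cases h : x * t ∈ F
    · refine Or.inl ⟨h, fun h' => ht ((H.mul_mem_cancel_left hx.2).1 h'.2)⟩
    · exact Or.inr ⟨⟨x, hx.1, rfl⟩, h⟩
  have h3 : (F \ A).card + A.card = F.card :=
    Finset.card_sdiff_add_card_eq_card (Finset.filter_subset _ _)
  omega

/-- If `G` is a finitely generated amenable group (with the word metric from a
finite generating set `S`) and `H` is a proper subgroup of finite index `n > 1`, then the
inclusion `H ↪ G` is not a bounded distance from a bijection. -/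
theorem inclusion_not_bounded_distance_from_bijection
    {G : Type*} [Group G] (S : Set G) (hSfin : S.Finite)
    (hSgen : Subgroup.closure S = ⊤)
    (hamen : ∃ F : ℕ → Finset G, IsFolner S F)
    (H : Subgroup G) (hproper : H ≠ ⊤) (n : ℕ) (hn : 1 < n) (hindex : H.index = n) :
    ¬ ∃ b : H → G, Function.Bijective b ∧
        ∃ M : ℝ, ∀ h : H, wordDist S (h : G) (b h) ≤ M := by
  rintro ⟨b, hb, M, hM⟩
  obtain ⟨F, hF⟩ := hamen
  obtain ⟨t, ht⟩ : ∃ t, t ∉ H := by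
    by_contra h
    push Not at h
    exact hproper ((Subgroup.eq_top_iff' H).2 h)
  have hfin := (ball_finite S hSfin hSgen ⌊M⌋₊).inv
  have hB : ∀ h : H, (b h)⁻¹ * (h : G) ∈ hfin.toFinset := by
    intro h
    have := hM h
    simp only [Set.Finite.mem_toFinset, Set.mem_inv, Set.mem_ofPred_eq, mul_inv_rev, inv_inv]
    exact Nat.le_floor this
  have hlim : Filter.Tendsto (fun i => 2 * ∑ k ∈ hfin.toFinset,
      (moved (F i) k : ℝ) / ((F i).card : ℝ) + (moved (F i) t : ℝ) / ((F i).card : ℝ))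
      Filter.atTop (nhds (2 * ∑ k ∈ hfin.toFinset, (0 : ℝ) + 0)) :=
    ((tendsto_finsetSum _ (fun k _ => moved_tendsto S hSfin hSgen F hF k)).const_mul 2).add
      (moved_tendsto S hSfin hSgen F hF t)
  have hge : (1 : ℝ) ≤ 2 * ∑ k ∈ hfin.toFinset, (0 : ℝ) + 0 := by
    refine ge_of_tendsto' hlim (fun i => ?_)
    have hpos : (0 : ℝ) < (F i).card := by exact_mod_cast (hF.1 i).card_pos
    rw [← Finset.sum_div, ← mul_div_assoc, ← add_div, le_div_iff₀ hpos, one_mul]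
    exact_mod_cast key_count (F i) _ H t ht b hb hB
  norm_num at hge
end

section
/- Let φ : H → G be a homomorphism of finitely generated groups whose image has finite index n = [G : φ(H)] and whose kernel is finite with exactly n = |ker φ| elements. Then φ is a bounded distance from a bijection: there exists a bijection b : H → G with sup_{h ∈ H} d(φ(h), b(h)) < ∞ (distance in the word metric of G). -/
open Filter

/-- A homomorphism `φ : H → G` of finitely generated groups whose image has
finite index `n` and whose kernel has exactly `n` elements is a bounded distance from a
bijection (w.r.t. the word metric on `G`). -/
theorem homomorphism_bounded_distance_from_bijection
    {H G : Type*} [Group H] [Group G] [Group.FG H]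
    (S : Set G) (hSfin : S.Finite) (hSgen : Subgroup.closure S = ⊤)
    (φ : H →* G) (n : ℕ) (hn : 0 < n)
    (hindex : φ.range.index = n)
    (hker : Nat.card φ.ker = n) :
    ∃ b : H → G, Function.Bijective b ∧ ∃ M : ℝ, ∀ h : H, wordDist S (φ h) (b h) ≤ M := by
  classical
  have hQ : Nat.card (G ⧸ φ.range) = n := hindex
  have : Finite (G ⧸ φ.range) := Nat.finite_of_card_ne_zero (by omega)
  have : Finite φ.ker := Nat.finite_of_card_ne_zero (by omega)
  obtain ⟨e⟩ : Nonempty (φ.ker ≃ G ⧸ φ.range) := Finite.card_eq.1 (by omega)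
  have hσ : ∀ r : φ.range, ∃ h : H, φ h = r := fun r => r.2
  choose σ hσ using hσ
  let ρ : H → H := fun h => σ ⟨φ h, h, rfl⟩
  have hρ : ∀ h, φ (ρ h) = φ h := fun h => hσ _
  have hρ' : ∀ h h', φ h = φ h' → ρ h = ρ h' := by
    intro h h' hh
    simp only [ρ, hh]
  have hk : ∀ h, (ρ h)⁻¹ * h ∈ φ.ker := by
    intro h
    simp [MonoidHom.mem_ker, hρ]
  let k : H → φ.ker := fun h => ⟨(ρ h)⁻¹ * h, hk h⟩
  refine ⟨fun h => φ h * (e (k h)).out⁻¹, ⟨?_, ?_⟩, ?_⟩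
  · intro h h' hh
    have hh : φ h * (e (k h)).out⁻¹ = φ h' * (e (k h')).out⁻¹ := hh
    have h1 : e (k h) = e (k h') := by
      rw [← QuotientGroup.out_eq' (e (k h)), ← QuotientGroup.out_eq' (e (k h')), QuotientGroup.eq]
      refine ⟨h⁻¹ * h', ?_⟩
      rw [map_mul, map_inv, inv_mul_eq_iff_eq_mul, ← mul_assoc, hh]
      group
    rw [h1] at hh
    have h2 : φ h = φ h' := mul_right_cancel hh
    have h3 : (ρ h)⁻¹ * h = (ρ h')⁻¹ * h' := congrArg Subtype.val (e.injective h1)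
    rw [hρ' h h' h2] at h3
    exact mul_left_cancel h3
  · intro g
    have h1 : ((QuotientGroup.mk g⁻¹ : G ⧸ φ.range)) =
        QuotientGroup.mk (QuotientGroup.mk g⁻¹ : G ⧸ φ.range).out :=
      (QuotientGroup.out_eq' _).symm
    rw [QuotientGroup.eq, inv_inv] at h1
    obtain ⟨h0, h0e⟩ := h1
    generalize (QuotientGroup.mk g⁻¹ : G ⧸ φ.range) = q at h0e
    have h2 : φ (ρ h0 * (e.symm q : H)) = φ h0 := by
      rw [map_mul, hρ, (MonoidHom.mem_ker).1 (e.symm q).2, mul_one]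
    refine ⟨ρ h0 * (e.symm q : H), ?_⟩
    have h3 : k (ρ h0 * (e.symm q : H)) = e.symm q := by
      apply Subtype.ext
      simp only [k, hρ' _ _ h2, inv_mul_cancel_left]
    simp only [h3, h2, h0e, Equiv.apply_symm_apply, mul_inv_cancel_right]
  · obtain ⟨M, hM⟩ := (Set.finite_range
      (fun q : G ⧸ φ.range => (wordLength S q.out⁻¹ : ℝ))).bddAbove
    refine ⟨M, fun h => ?_⟩
    simp only [wordDist, inv_mul_cancel_left]
    exact hM ⟨e (k h), rfl⟩
end

section
/- Let G be a finitely generated group with the word metric, and suppose G contains a subset G' and elements g_1, …, g_n such that G is the disjoint union of the sets G'g_1, …, G'g_n. Suppose f : G' → G is a bijective quasi-isometry, where G' carries the metric restricted from G. Then the map f' : G → G defined by f'(g'g_i) = f(g') for g' ∈ G' and 1 ≤ i ≤ n is an n-to-1 self quasi-isometry of G. -/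
open Filter

theorem wl_exists {G : Type*} [Group G] (S : Set G) (hSgen : Subgroup.closure S = ⊤) (x : G) :
    ∃ w : List G, w.length = wordLength S x ∧ (∀ x ∈ w, x ∈ S ∨ x⁻¹ ∈ S) ∧ w.prod = x := by
  have hx : x ∈ Subgroup.closure S := by rw [hSgen]; trivial
  rw [← Subgroup.mem_toSubmonoid, Subgroup.closure_toSubmonoid] at hx
  obtain ⟨l, hl, hp⟩ := Submonoid.exists_list_of_mem_closure hx
  exact Nat.sInf_mem (s := {n : ℕ | ∃ w : List G, w.length = n ∧
    (∀ x ∈ w, x ∈ S ∨ x⁻¹ ∈ S) ∧ w.prod = x}) ⟨l.length, l, rfl, hl, hp⟩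

theorem wl_mul {G : Type*} [Group G] (S : Set G) (hSgen : Subgroup.closure S = ⊤) (x y : G) :
    wordLength S (x * y) ≤ wordLength S x + wordLength S y := by
  obtain ⟨u, hu, hu', hux⟩ := wl_exists S hSgen x
  obtain ⟨v, hv, hv', hvy⟩ := wl_exists S hSgen y
  apply Nat.sInf_le
  refine ⟨u ++ v, by simp [hu, hv], ?_, by simp [hux, hvy]⟩
  intro z hz
  rcases List.mem_append.1 hz with h | h
  · exact hu' z h
  · exact hv' z h

/-- Suppose `G` (finitely generated, word metric) is the disjoint union of the
sets `G'g 1, …, G'g n` (each `x ∈ G` has a unique representation `x = g' * g i` with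
`g' ∈ G'`), and `f : G' → G` is a bijective quasi-isometry (`G'` carrying the restricted
metric). Then the map `f' : G → G` with `f'(g' * g i) = f g'` is an `n`-to-`1` self
quasi-isometry of `G`. -/
theorem extension_is_n_to_one_self_quasiIsometry
    {G : Type*} [Group G] (S : Set G) (hSfin : S.Finite) (hSgen : Subgroup.closure S = ⊤)
    (G' : Set G) (n : ℕ) (g : Fin n → G)
    (hdecomp : ∀ x : G, ∃! p : G' × Fin n, (p.1 : G) * g p.2 = x)
    (f : G' → G) (hfbij : Function.Bijective f)
    (hfqi : IsQuasiIsometry (fun a b : G' => wordDist S (a : G) (b : G)) (wordDist S) f)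
    (f' : G → G) (hf' : ∀ (x : G') (i : Fin n), f' ((x : G) * g i) = f x) :
    IsQuasiIsometry (wordDist S) (wordDist S) f' ∧
      ∀ y : G, (f' ⁻¹' {y}).ncard = n := by
  obtain ⟨K, C, hK, hC, hqi, hdense⟩ := hfqi
  have hn : Nonempty (Fin n) := by
    obtain ⟨p, -, -⟩ := hdecomp 1
    exact ⟨p.2⟩
  obtain ⟨i0⟩ := hn
  refine ⟨?_, ?_⟩
  · set R : ℕ := ∑ i, (wordLength S (g i) + wordLength S (g i)⁻¹) with hR
    have hRi : ∀ i, wordLength S (g i) + wordLength S (g i)⁻¹ ≤ R := fun i =>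
      Finset.single_le_sum (f := fun i => wordLength S (g i) + wordLength S (g i)⁻¹)
        (fun _ _ => Nat.zero_le _) (Finset.mem_univ i)
    have hR0 : (0 : ℝ) ≤ R := Nat.cast_nonneg R
    have hK0 : 0 < K := by linarith
    have hKR : (R : ℝ) ≤ K * R := by nlinarith
    refine ⟨K, C + 2 * (K * R), hK, by positivity, ?_, ?_⟩
    · intro x x'
      obtain ⟨⟨a, i⟩, ha, -⟩ := hdecomp x
      obtain ⟨⟨b, j⟩, hb, -⟩ := hdecomp x'
      simp only at ha hb
      subst ha hb
      rw [hf', hf']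
      obtain ⟨h1, h2⟩ := hqi a b
      have e1 : wordDist S ((a : G) * g i) (b * g j) ≤ wordDist S (a : G) b + 2 * R := by
        have q1 := wl_mul S hSgen ((g i)⁻¹ * ((a : G)⁻¹ * b)) (g j)
        have q2 := wl_mul S hSgen (g i)⁻¹ ((a : G)⁻¹ * b)
        have q3 := hRi i
        have q4 := hRi j
        have e : ((a : G) * g i)⁻¹ * (b * g j) = (g i)⁻¹ * ((a : G)⁻¹ * b) * g j := by group
        unfold wordDist
        rw [e]
        norm_cast
        omega
      have e2 : wordDist S (a : G) b ≤ wordDist S ((a : G) * g i) (b * g j) + 2 * R := by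
        have q1 := wl_mul S hSgen (g i * (((a : G) * g i)⁻¹ * (b * g j))) (g j)⁻¹
        have q2 := wl_mul S hSgen (g i) (((a : G) * g i)⁻¹ * (b * g j))
        have q3 := hRi i
        have q4 := hRi j
        have e : (a : G)⁻¹ * b = g i * (((a : G) * g i)⁻¹ * (b * g j)) * (g j)⁻¹ := by group
        unfold wordDist
        rw [e]
        norm_cast
        omega
      constructor
      · have e3 : wordDist S ((a : G) * g i) (b * g j) / K ≤ wordDist S (a : G) b / K + 2 * R := by
          rw [div_add' _ _ _ hK0.ne']
          gcongr
          nlinarith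
        linarith
      · have := mul_le_mul_of_nonneg_left e2 hK0.le
        linarith
    · intro y
      obtain ⟨a, ha⟩ := hdense y
      refine ⟨a * g i0, ?_⟩
      rw [hf']
      have : 0 ≤ K * R := by positivity
      linarith
  · intro y
    obtain ⟨a, rfl⟩ := hfbij.2 y
    have hset : f' ⁻¹' {f a} = (fun i : Fin n => (a : G) * g i) '' Set.univ := by
      ext x
      simp only [Set.mem_preimage, Set.mem_singleton_iff, Set.image_univ, Set.mem_range]
      constructor
      · intro hx
        obtain ⟨⟨b, j⟩, hb, -⟩ := hdecomp x
        simp only at hb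
        subst hb
        rw [hf'] at hx
        rw [hfbij.1 hx]
        exact ⟨j, rfl⟩
      · rintro ⟨i, rfl⟩
        exact hf' a i
    have hinj : Function.Injective (fun i : Fin n => (a : G) * g i) := by
      intro i j hij
      have := (hdecomp ((a : G) * g j)).unique (y₁ := (a, i)) (y₂ := (a, j)) hij rfl
      exact (Prod.ext_iff.1 this).2
    rw [hset, Set.ncard_image_of_injective _ hinj, Set.ncard_univ, Nat.card_eq_fintype_card,
      Fintype.card_fin]
end

section
/- Let G be a finitely generated group with the word metric, and let G' ≤ G be a subgroup of index n such that there exists a group isomorphism f : G' → G. Then G admits an n-to-1 self quasi-isometry. -/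
open Filter

theorem exists_word {G : Type*} [Group G] {S : Set G} (hS : Subgroup.closure S = ⊤) (g : G) :
    ∃ w : List G, w.length = wordLength S g ∧ (∀ x ∈ w, x ∈ S ∨ x⁻¹ ∈ S) ∧ w.prod = g := by
  have hne : {n : ℕ | ∃ w : List G, w.length = n ∧ (∀ x ∈ w, x ∈ S ∨ x⁻¹ ∈ S) ∧
      w.prod = g}.Nonempty := by
    have hg : g ∈ (Subgroup.closure S).toSubmonoid := by rw [hS]; trivial
    rw [Subgroup.closure_toSubmonoid] at hg
    obtain ⟨l, hl, hp⟩ := Submonoid.exists_list_of_mem_closure hg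
    exact ⟨l.length, l, rfl, fun x hx => by simpa using hl x hx, hp⟩
  exact Nat.sInf_mem hne

theorem wordLength_le {G : Type*} [Group G] {S : Set G} (w : List G)
    (hw : ∀ x ∈ w, x ∈ S ∨ x⁻¹ ∈ S) : wordLength S w.prod ≤ w.length :=
  Nat.sInf_le ⟨w, rfl, hw, rfl⟩

theorem wordLength_mul_le {G : Type*} [Group G] {S : Set G} (hS : Subgroup.closure S = ⊤)
    (g h : G) : wordLength S (g * h) ≤ wordLength S g + wordLength S h := by
  obtain ⟨v, hv, hv', hvp⟩ := exists_word hS g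
  obtain ⟨w, hw, hw', hwp⟩ := exists_word hS h
  have := wordLength_le (S := S) (v ++ w) (by
    intro x hx
    rcases List.mem_append.1 hx with h | h
    · exact hv' x h
    · exact hw' x h)
  rw [List.prod_append, List.length_append, hv, hw, hvp, hwp] at this
  exact this

theorem wordLength_one {G : Type*} [Group G] (S : Set G) : wordLength S 1 = 0 := by
  simpa using wordLength_le (S := S) [] (by simp)

theorem lipschitz_of_gen {G : Type*} [Group G] {S : Set G} (hS : Subgroup.closure S = ⊤)
    (h : G → G) (K : ℕ)
    (hK : ∀ x s, (s ∈ S ∨ s⁻¹ ∈ S) → wordLength S ((h x)⁻¹ * h (x * s)) ≤ K) (x y : G) :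
    wordLength S ((h x)⁻¹ * h y) ≤ K * wordLength S (x⁻¹ * y) := by
  have key : ∀ w : List G, (∀ x ∈ w, x ∈ S ∨ x⁻¹ ∈ S) → ∀ x : G,
      wordLength S ((h x)⁻¹ * h (x * w.prod)) ≤ K * w.length := by
    intro w
    induction w with
    | nil => intro _ x; simp [wordLength_one]
    | cons s w ih =>
      intro hw x
      have h1 := ih (fun a ha => hw a (List.mem_cons_of_mem _ ha)) (x * s)
      have h2 := hK x s (hw s List.mem_cons_self)
      have h3 := wordLength_mul_le hS ((h x)⁻¹ * h (x * s))
        ((h (x * s))⁻¹ * h (x * s * w.prod))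
      have e : (h x)⁻¹ * h (x * s) * ((h (x * s))⁻¹ * h (x * s * w.prod)) =
        (h x)⁻¹ * h (x * (s :: w).prod) := by
        rw [List.prod_cons, ← mul_assoc x]; group
      rw [e] at h3
      rw [List.length_cons, mul_add, mul_one]
      omega
  obtain ⟨w, hw, hw', hwp⟩ := exists_word hS (x⁻¹ * y)
  have := key w hw' x
  rwa [hwp, hw, mul_inv_cancel_left] at this

theorem exists_bound {G : Type*} [Group G] (S : Set G) {A : Set G} (hA : A.Finite) :
    ∃ K : ℕ, ∀ a ∈ A, wordLength S a ≤ K := by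
  obtain ⟨K, hK⟩ := (hA.image (wordLength S)).bddAbove
  exact ⟨K, fun a ha => hK ⟨a, ha, rfl⟩⟩

open scoped Pointwise in
/-- If a finitely generated group `G` (word metric) has a subgroup `G'` of
index `n` which is isomorphic to `G`, then `G` admits an `n`-to-`1` self quasi-isometry. -/
theorem exists_n_to_one_self_quasiIsometry_of_isomorphic_finite_index_subgroup
    {G : Type*} [Group G] (S : Set G) (hSfin : S.Finite) (hSgen : Subgroup.closure S = ⊤)
    (G' : Subgroup G) (n : ℕ) (hn : 0 < n) (hindex : G'.index = n)
    (f : G' ≃* G) :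
    ∃ ψ : G → G, IsQuasiIsometry (wordDist S) (wordDist S) ψ ∧
      ∀ y : G, (ψ ⁻¹' {y}).ncard = n := by
  classical
  obtain ⟨T, hT, -⟩ := G'.exists_isComplement_right 1
  have hTc : T.ncard = n := by rw [hT.ncard_right, hindex]
  have hTf : T.Finite := Set.finite_of_ncard_pos (by omega)
  let p : G → G' := fun g => (hT.equiv g).1
  let t : G → G := fun g => (hT.equiv g).2
  have ht : ∀ g, t g ∈ T := fun g => (hT.equiv g).2.2
  have hpt : ∀ g, (p g : G) * t g = g := fun g => hT.equiv_fst_mul_equiv_snd g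
  have hp : ∀ g, (p g : G) = g * (t g)⁻¹ := fun g => eq_mul_inv_of_mul_eq (hpt g)
  let A : Set G := S ∪ S⁻¹
  have hA : A.Finite := hSfin.union hSfin.inv
  have hmA : ∀ s, (s ∈ S ∨ s⁻¹ ∈ S) → s ∈ A := fun s hs => hs
  -- upper constant
  have hB : (f '' ((fun x : G' => (x : G)) ⁻¹' (T * A * T⁻¹))).Finite :=
    (((hTf.mul hA).mul hTf.inv).preimage Subtype.val_injective.injOn).image _
  obtain ⟨K₁, hK₁⟩ := exists_bound S hB
  obtain ⟨K₂, hK₂⟩ := exists_bound S (hA.image (fun s => (f.symm s : G)))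
  obtain ⟨M, hM⟩ := exists_bound S (hTf.union hTf.inv)
  have up := lipschitz_of_gen hSgen (fun g => f (p g)) K₁ (by
    intro x s hs
    apply hK₁
    refine ⟨(p x)⁻¹ * p (x * s), ?_, by simp⟩
    refine Set.mem_mul.2 ⟨t x * s, Set.mul_mem_mul (ht x) (hmA s hs), (t (x * s))⁻¹,
      Set.inv_mem_inv.2 (ht _), ?_⟩
    simp only [Subgroup.coe_mul, Subgroup.coe_inv, hp]
    group)
  have low := lipschitz_of_gen hSgen (fun g => (f.symm g : G)) K₂ (by
    intro x s hs
    apply hK₂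
    exact ⟨s, hmA s hs, by simp⟩)
  have low' : ∀ x y, wordLength S (x⁻¹ * y) ≤
      K₂ * wordLength S ((f (p x))⁻¹ * f (p y)) + 2 * M := by
    intro x y
    have h1 := low (f (p x)) (f (p y))
    simp only [MulEquiv.symm_apply_apply] at h1
    have h2 := wordLength_mul_le hSgen ((t x)⁻¹ * ((p x : G)⁻¹ * p y)) (t y)
    have h3 := wordLength_mul_le hSgen (t x)⁻¹ ((p x : G)⁻¹ * p y)
    have h4 := hM (t y) (Or.inl (ht y))
    have h5 := hM (t x)⁻¹ (Or.inr (Set.inv_mem_inv.2 (ht x)))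
    have e : (t x)⁻¹ * ((p x : G)⁻¹ * p y) * t y = x⁻¹ * y := by
      simp only [hp]; group
    rw [e] at h2
    omega
  refine ⟨fun g => f (p g), ⟨K₁ + K₂ + 1, 2 * M, ?_, by positivity, ?_, ?_⟩, ?_⟩
  · have : (0 : ℝ) ≤ K₁ + K₂ := by positivity
    linarith
  · intro x y
    have u : (wordLength S ((f (p x))⁻¹ * f (p y)) : ℝ) ≤ K₁ * wordLength S (x⁻¹ * y) := by
      exact_mod_cast up x y
    have l : (wordLength S (x⁻¹ * y) : ℝ) ≤
        K₂ * wordLength S ((f (p x))⁻¹ * f (p y)) + 2 * M := by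
      exact_mod_cast low' x y
    unfold wordDist
    have a1 : (0 : ℝ) ≤ wordLength S ((f (p x))⁻¹ * f (p y)) := by positivity
    have a2 : (0 : ℝ) ≤ wordLength S (x⁻¹ * y) := by positivity
    have k1 : (0 : ℝ) ≤ K₁ := by positivity
    have k2 : (0 : ℝ) ≤ K₂ := by positivity
    have m : (0 : ℝ) ≤ M := by positivity
    constructor
    · rw [neg_add_le_iff_le_add, div_le_iff₀ (by positivity)]
      nlinarith [mul_nonneg k1 a1, mul_nonneg k1 m, mul_nonneg k2 m]
    · nlinarith [mul_nonneg k2 a2]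
  · intro y
    have hy : (f (p (hT.equiv.symm (f.symm y, (hT.equiv 1).2)))) = y := by
      simp only [p, Equiv.apply_symm_apply]
      exact f.apply_symm_apply y
    refine ⟨hT.equiv.symm (f.symm y, (hT.equiv 1).2), le_of_eq_of_le ?_ (by positivity : (0 : ℝ) ≤ 2 * M)⟩
    · simp only [hy, wordDist, inv_mul_cancel, wordLength_one, Nat.cast_zero]
  · intro y
    have e : (fun g => f (p g)) ⁻¹' {y} = (fun u => (f.symm y : G) * u) '' T := by
      ext g
      simp only [Set.mem_preimage, Set.mem_singleton_iff, Set.mem_image]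
      constructor
      · intro h
        exact ⟨t g, ht g, by rw [← h, f.symm_apply_apply, hpt]⟩
      · rintro ⟨u, hu, rfl⟩
        have : (f.symm y : G) * u = hT.equiv.symm (f.symm y, ⟨u, hu⟩) := rfl
        rw [this]
        simp only [p, Equiv.apply_symm_apply]
        exact f.apply_symm_apply y
    rw [e, Set.ncard_image_of_injective _ (mul_right_injective _), hTc]
end

section
/- Let G be a finitely generated group with the word metric, let H ≤ G be a subgroup of finite index n, and let i : H → G denote the inclusion. Suppose f : H → H is an n-to-1 self quasi-isometry of H (H equipped with the metric restricted from G). Then the composition i∘f : H → G is a bounded distance from a bijection: there exists a bijection b : H → G with sup_{h ∈ H} d(f(h), b(h)) < ∞ (distance in G). -/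
open Filter

/-- Let `H ≤ G` have finite index `n` in a finitely generated group `G`
(word metric), and let `f : H → H` be an `n`-to-`1` self quasi-isometry of `H` (restricted
metric). Then the composition of `f` with the inclusion `H ↪ G` is a bounded distance from a
bijection. -/
theorem inclusion_comp_n_to_one_bounded_distance_from_bijection
    {G : Type*} [Group G] (S : Set G) (hSfin : S.Finite) (hSgen : Subgroup.closure S = ⊤)
    (H : Subgroup G) (n : ℕ) (hn : 0 < n) (hindex : H.index = n)
    (f : H → H)
    (hfqi : IsQuasiIsometry (fun a b : H => wordDist S (a : G) (b : G))
      (fun a b : H => wordDist S (a : G) (b : G)) f)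
    (hfib : ∀ y : H, (f ⁻¹' {y}).ncard = n) :
    ∃ b : H → G, Function.Bijective b ∧
      ∃ M : ℝ, ∀ h : H, wordDist S ((f h : G)) (b h) ≤ M := by
  classical
  have hidx : H.index ≠ 0 := by omega
  have : Finite (G ⧸ H) := Nat.finite_of_card_ne_zero hidx
  have he : ∀ y : H, Nonempty ((f ⁻¹' {y} : Set H) ≃ G ⧸ H) := by
    intro y
    have h1 : Nat.card (f ⁻¹' {y} : Set H) = n := hfib y
    have : Finite (f ⁻¹' {y} : Set H) := Nat.finite_of_card_ne_zero (by omega)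
    exact (Finite.card_eq).mp (h1.trans hindex.symm)
  let e : ∀ y : H, (f ⁻¹' {y} : Set H) ≃ G ⧸ H := fun y => (he y).some
  let c : H → G ⧸ H := fun h => e (f h) ⟨h, rfl⟩
  have hc : ∀ (y : H) (x : (f ⁻¹' {y} : Set H)), f x.1 = y ∧ c x.1 = e y x := by
    rintro y ⟨x, hx⟩
    have hx' : f x = y := hx
    subst hx'
    exact ⟨rfl, rfl⟩
  have hcinj : ∀ h h' : H, f h = f h' → c h = c h' → h = h' := by
    intro h h' h1 h2
    have h3 := (hc (f h') ⟨h, h1⟩).2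
    have h4 : e (f h') ⟨h, h1⟩ = e (f h') ⟨h', rfl⟩ := h3.symm.trans h2
    exact congrArg Subtype.val ((e (f h')).injective h4)
  refine ⟨fun h => (f h : G) * ((c h).out)⁻¹, ⟨?_, ?_⟩, ?_⟩
  · intro h h' hh
    have hh' : (f h : G) * ((c h).out)⁻¹ = (f h' : G) * ((c h').out)⁻¹ := hh
    have hq : c h = c h' := by
      rw [← Quotient.out_eq (c h), ← Quotient.out_eq (c h')]
      refine QuotientGroup.eq.mpr ?_
      have h5 : ((c h).out)⁻¹ * (c h').out = (f h : G)⁻¹ * (f h' : G) := by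
        rw [eq_inv_mul_iff_mul_eq, ← mul_assoc, hh', inv_mul_cancel_right]
      rw [h5]
      exact H.mul_mem (H.inv_mem (f h).2) (f h').2
    rw [hq] at hh'
    exact hcinj h h' (Subtype.ext (mul_right_cancel hh')) hq
  · intro g
    let q : G ⧸ H := QuotientGroup.mk g⁻¹
    have hm : g * q.out ∈ H := by
      have h6 : (QuotientGroup.mk g⁻¹ : G ⧸ H) = QuotientGroup.mk q.out :=
        (Quotient.out_eq q).symm
      simpa using QuotientGroup.eq.mp h6
    let y : H := ⟨g * q.out, hm⟩
    obtain ⟨h7, h8⟩ := hc y ((e y).symm q)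
    refine ⟨((e y).symm q).1, ?_⟩
    rw [Equiv.apply_symm_apply] at h8
    show (f ((e y).symm q).1 : G) * ((c ((e y).symm q).1).out)⁻¹ = g
    rw [h7, h8]
    exact mul_inv_cancel_right g q.out
  · obtain ⟨M, hM⟩ := (Set.finite_range
      (fun q : G ⧸ H => (wordLength S (q.out)⁻¹ : ℝ))).bddAbove
    refine ⟨M, fun h => ?_⟩
    have h9 := hM (Set.mem_range_self (c h))
    simpa [wordDist] using h9
end

section
/- Fix integers m ≥ 2 and n ≥ 1, and let BS(1,m) = ⟨a, b ∣ aba⁻¹ = b^m⟩ be the solvable Baumslag–Solitar group, equipped with the word metric coming from the generating set {a, b}. Then BS(1,m) admits an n-to-1 self quasi-isometry. -/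
open Filter

/-- The single relator `a b a⁻¹ (b^m)⁻¹` of the solvable Baumslag–Solitar group `BS(1,m)`,
where `a = FreeGroup.of true` and `b = FreeGroup.of false`. -/
def BSRels (m : ℕ) : Set (FreeGroup Bool) :=
  {FreeGroup.of true * FreeGroup.of false * (FreeGroup.of true)⁻¹ * (FreeGroup.of false ^ m)⁻¹}

/-- The solvable Baumslag–Solitar group `BS(1,m) = ⟨a, b ∣ a b a⁻¹ = b^m⟩`. -/
abbrev BS (m : ℕ) : Type := PresentedGroup (BSRels m)


namespace BSaux

section general
variable {G : Type*} [Group G] {S : Set G}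

lemma wl_le (w : List G) (hw : ∀ x ∈ w, x ∈ S ∨ x⁻¹ ∈ S) : wordLength S w.prod ≤ w.length :=
  Nat.sInf_le ⟨w, rfl, hw, rfl⟩

lemma wl_exists (hS : Subgroup.closure S = ⊤) (g : G) :
    ∃ w : List G, w.length = wordLength S g ∧ (∀ x ∈ w, x ∈ S ∨ x⁻¹ ∈ S) ∧ w.prod = g := by
  have hg : g ∈ Subgroup.closure S := by rw [hS]; trivial
  rw [← Subgroup.mem_toSubmonoid, Subgroup.closure_toSubmonoid] at hg
  obtain ⟨l, h1, h2⟩ := Submonoid.exists_list_of_mem_closure hg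
  exact Nat.sInf_mem (s := {n : ℕ | ∃ w : List G, w.length = n ∧
    (∀ x ∈ w, x ∈ S ∨ x⁻¹ ∈ S) ∧ w.prod = g}) ⟨l.length, l, rfl, h1, h2⟩

lemma wl_mul (hS : Subgroup.closure S = ⊤) (g h : G) :
    wordLength S (g * h) ≤ wordLength S g + wordLength S h := by
  obtain ⟨v, hv, hv', rfl⟩ := wl_exists hS g
  obtain ⟨w, hw, hw', rfl⟩ := wl_exists hS h
  rw [← hv, ← hw, ← List.prod_append, ← List.length_append]
  apply wl_le
  intro x hx
  rcases List.mem_append.1 hx with h | h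
  · exact hv' x h
  · exact hw' x h

lemma wl_inv_le (hS : Subgroup.closure S = ⊤) (g : G) :
    wordLength S g⁻¹ ≤ wordLength S g := by
  obtain ⟨v, hv, hv', rfl⟩ := wl_exists hS g
  rw [← hv, List.prod_inv_reverse]
  refine (wl_le _ ?_).trans (by simp)
  intro x hx
  simp only [List.mem_reverse, List.mem_map] at hx
  obtain ⟨y, hy, rfl⟩ := hx
  rcases hv' y hy with h | h
  · right; simpa using h
  · left; exact h

lemma wl_one : wordLength S (1 : G) = 0 := by
  have := wl_le (S := S) ([] : List G) (by simp)
  simpa using this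

lemma wl_gen {s : G} (hs : s ∈ S) : wordLength S s ≤ 1 := by
  have := wl_le (S := S) [s] (by simp [hs])
  simpa using this

lemma wl_pow (hS : Subgroup.closure S = ⊤) {s : G} (hs : s ∈ S) (k : ℕ) :
    wordLength S (s ^ k) ≤ k := by
  have := wl_le (S := S) (List.replicate k s)
    (by intro x hx; left; rw [List.eq_of_mem_replicate hx]; exact hs)
  simpa using this

lemma wl_zpow (hS : Subgroup.closure S = ⊤) {s : G} (hs : s ∈ S) (k : ℤ) :
    wordLength S (s ^ k) ≤ k.natAbs := by
  rcases Int.eq_nat_or_neg k with ⟨j, rfl | rfl⟩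
  · simpa using wl_pow hS hs j
  · have := (wl_inv_le hS (s ^ j)).trans (wl_pow hS hs j)
    simpa using this

lemma lipschitz (hS : Subgroup.closure S = ⊤) (f : G → G) (C : ℕ)
    (hf : ∀ g, ∀ s ∈ S, wordLength S ((f g)⁻¹ * f (g * s)) ≤ C) (x y : G) :
    wordLength S ((f x)⁻¹ * f y) ≤ C * wordLength S (x⁻¹ * y) := by
  obtain ⟨w, hw, hw', hp⟩ := wl_exists hS (x⁻¹ * y)
  rw [← hw]
  have hy : y = x * w.prod := by rw [hp]; group
  subst hy
  clear hp hw
  induction w generalizing x with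
  | nil => simp [wl_one]
  | cons s w ih =>
    have h1 := ih (x * s) (fun z hz => hw' z (List.mem_cons_of_mem _ hz))
    have h2 : wordLength S ((f x)⁻¹ * f (x * s)) ≤ C := by
      rcases hw' s (by simp) with h | h
      · exact hf x s h
      · have h3 := hf (x * s) s⁻¹ h
        have h4 := wl_inv_le hS ((f (x * s))⁻¹ * f (x * s * s⁻¹))
        simp only [mul_inv_rev, inv_inv, mul_inv_cancel_right] at h3 h4
        exact h4.trans h3
    have h5 := wl_mul hS ((f x)⁻¹ * f (x * s)) ((f (x * s))⁻¹ * f (x * s * w.prod))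
    rw [List.prod_cons, List.length_cons, ← mul_assoc x]
    have h6 : (f x)⁻¹ * f (x * s) * ((f (x * s))⁻¹ * f (x * s * w.prod))
      = (f x)⁻¹ * f (x * s * w.prod) := by group
    rw [h6] at h5
    calc _ ≤ _ := h5
      _ ≤ C + C * w.length := add_le_add h2 h1
      _ = _ := by ring

end general

abbrev A (m : ℕ) : BS m := PresentedGroup.of true
abbrev B (m : ℕ) : BS m := PresentedGroup.of false
abbrev gens (m : ℕ) : Set (BS m) := {PresentedGroup.of true, PresentedGroup.of false}

lemma gens_closure (m : ℕ) : Subgroup.closure (gens m) = ⊤ := by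
  rw [← PresentedGroup.closure_range_of (BSRels m)]
  congr 1
  ext x
  simp [gens, eq_comm, or_comm]

lemma rel (m : ℕ) : A m * B m * (A m)⁻¹ = B m ^ m := by
  have h : (PresentedGroup.mk (BSRels m)) (FreeGroup.of true * FreeGroup.of false *
      (FreeGroup.of true)⁻¹ * (FreeGroup.of false ^ m)⁻¹) = 1 :=
    PresentedGroup.one_of_mem (by simp [BSRels])
  simp only [map_mul, map_inv, map_pow] at h
  exact mul_inv_eq_one.1 h

lemma rel_zpow (m : ℕ) (k : ℤ) : A m * B m ^ k = B m ^ (m * k : ℤ) * A m := by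
  have h : A m * B m ^ k * (A m)⁻¹ = B m ^ (m * k : ℤ) := by
    rw [← conj_zpow, rel, zpow_mul, zpow_natCast]
  rw [← h]; group

/-- The action of the generators on the rationals. -/
def genPerm (m : ℕ) (hm : (m : ℚ) ≠ 0) : Bool → Equiv.Perm ℚ
  | true => Equiv.mulLeft₀ (m : ℚ) hm
  | false => Equiv.addRight (1 : ℚ)

/-- The affine action of `BS(1,m)` on the rationals. -/
noncomputable def rho (m : ℕ) (hm : (m : ℚ) ≠ 0) : BS m →* Equiv.Perm ℚ :=
  PresentedGroup.toGroup (f := genPerm m hm) (by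
    have hp : ∀ (k : ℕ) (x : ℚ), ((Equiv.addRight (1 : ℚ)) ^ k) x = x + k := by
      intro k
      induction k with
      | zero => simp
      | succ k ih => intro x; rw [pow_succ]; simp [ih]; ring
    intro r hr
    rw [BSRels, Set.mem_singleton_iff] at hr
    subst hr
    simp only [map_mul, map_inv, map_pow, FreeGroup.lift_apply_of, genPerm]
    rw [mul_inv_eq_one, mul_inv_eq_iff_eq_mul]
    ext x
    simp [hp]
    ring)

/-- The horizontal coordinate. -/
noncomputable def J (m : ℕ) (hm : (m : ℚ) ≠ 0) (g : BS m) : ℤ := ⌊-(rho m hm g⁻¹ 0)⌋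

lemma J_B (m : ℕ) (hm : (m : ℚ) ≠ 0) (g : BS m) : J m hm (g * B m) = J m hm g + 1 := by
  have h : rho m hm (B m) = Equiv.addRight (1 : ℚ) := by
    simp [rho, genPerm]
  have h2 : rho m hm (g * B m)⁻¹ 0 = rho m hm g⁻¹ 0 - 1 := by
    rw [mul_inv_rev, map_mul, map_inv _ (B m), h]
    simp [sub_eq_add_neg]
  rw [J, h2, J, neg_sub, sub_eq_neg_add, Int.floor_add_one]

lemma J_A (m : ℕ) (hm : (m : ℚ) ≠ 0) (g : BS m) : J m hm (g * A m) = J m hm g / m := by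
  have h : rho m hm (A m) = Equiv.mulLeft₀ (m : ℚ) hm := by
    simp [rho, genPerm]
  have h2 : rho m hm (g * A m)⁻¹ 0 = rho m hm g⁻¹ 0 / m := by
    rw [mul_inv_rev, map_mul, map_inv _ (A m), h, Equiv.Perm.mul_apply, Equiv.Perm.inv_eq_iff_eq]
    simp
    field_simp
  rw [J, h2, J, ← neg_div, Int.floor_div_natCast]

lemma J_B_zpow (m : ℕ) (hm : (m : ℚ) ≠ 0) (g : BS m) (k : ℤ) :
    J m hm (g * B m ^ k) = J m hm g + k := by
  induction k with
  | zero => simp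
  | succ k ih => rw [zpow_add_one, ← mul_assoc, J_B, ih]; ring
  | pred k ih =>
    have := J_B m hm (g * B m ^ (-(k : ℤ) - 1))
    rw [mul_assoc, ← zpow_add_one, sub_add_cancel, ih] at this
    linarith

/-- Reparametrize each horizontal line by `h`. -/
noncomputable def shift (m : ℕ) (hm : (m : ℚ) ≠ 0) (h : ℤ → ℤ) (g : BS m) : BS m :=
  g * B m ^ (h (J m hm g) - J m hm g)

lemma J_shift (m : ℕ) (hm : (m : ℚ) ≠ 0) (h : ℤ → ℤ) (g : BS m) :
    J m hm (shift m hm h g) = h (J m hm g) := by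
  rw [shift, J_B_zpow]; ring

lemma shift_lip (m : ℕ) (hm : (m : ℚ) ≠ 0) (h : ℤ → ℤ) (C : ℕ)
    (h1 : ∀ j, (h (j + 1) - h j).natAbs ≤ C)
    (h2 : ∀ j, (j - m * (j / m) + (m * h (j / m) - h j)).natAbs ≤ C) (x y : BS m) :
    wordLength (gens m) ((shift m hm h x)⁻¹ * shift m hm h y)
      ≤ (C + 1) * wordLength (gens m) (x⁻¹ * y) := by
  apply lipschitz (gens_closure m)
  intro g s hs
  have hb : B m ∈ gens m := by simp [gens]
  have ha : A m ∈ gens m := by simp [gens]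
  rcases hs with rfl | hs
  · have e : (shift m hm h g)⁻¹ * shift m hm h (g * A m) =
        B m ^ (J m hm g - m * (J m hm g / m) + (m * h (J m hm g / m) - h (J m hm g))) * A m := by
      rw [shift, shift, J_A, mul_assoc g, rel_zpow, mul_inv_rev, ← zpow_neg]
      rw [mul_assoc, inv_mul_cancel_left, ← mul_assoc, ← zpow_add]
      congr 2
      ring
    change wordLength (gens m) ((shift m hm h g)⁻¹ * shift m hm h (g * A m)) ≤ _
    rw [e]
    exact (wl_mul (gens_closure m) _ _).trans (add_le_add
      ((wl_zpow (gens_closure m) hb _).trans (h2 _)) (wl_gen ha))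
  · have hs : s = B m := hs
    subst hs
    have e : (shift m hm h g)⁻¹ * shift m hm h (g * B m) =
        B m ^ (h (J m hm g + 1) - h (J m hm g)) := by
      rw [shift, shift, J_B, mul_assoc g, ← zpow_one_add, mul_inv_rev, ← zpow_neg]
      rw [mul_assoc, inv_mul_cancel_left, ← zpow_add]
      congr 1
      ring
    rw [e]
    exact ((wl_zpow (gens_closure m) hb _).trans (h1 _)).trans (Nat.le_succ _)

end BSaux

open BSaux in
/-- For `m ≥ 2` and `n ≥ 1`, the group `BS(1,m)`, with the word metric coming
from the generating set `{a, b}`, admits an `n`-to-`1` self quasi-isometry. -/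
theorem BS_exists_n_to_one_self_quasiIsometry (m n : ℕ) (hm : 2 ≤ m) (hn : 1 ≤ n) :
    ∃ ψ : BS m → BS m,
      IsQuasiIsometry
        (wordDist ({PresentedGroup.of true, PresentedGroup.of false} : Set (BS m)))
        (wordDist ({PresentedGroup.of true, PresentedGroup.of false} : Set (BS m))) ψ ∧
      ∀ y : BS m, (ψ ⁻¹' {y}).ncard = n := by
  have hm0 : (m : ℚ) ≠ 0 := by positivity
  have hmz : (0 : ℤ) < m := by omega
  have hnz : (0 : ℤ) < n := by omega
  have hcl := gens_closure m
  have hb : B m ∈ gens m := by simp [gens]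
  set ψ := shift m hm0 (fun j => j / n) with hψ
  set φ := shift m hm0 (fun j => n * j) with hφ
  have mod_m : ∀ j : ℤ, 0 ≤ j - m * (j / m) ∧ j - m * (j / m) < m := fun j => by
    have h1 := Int.emod_nonneg j hmz.ne'
    have h2 := Int.emod_lt_of_pos j hmz
    have h3 := Int.emod_add_mul_ediv j m
    constructor <;> linarith
  have mod_n : ∀ j : ℤ, 0 ≤ j - n * (j / n) ∧ j - n * (j / n) < n := fun j => by
    have h1 := Int.emod_nonneg j hnz.ne'
    have h2 := Int.emod_lt_of_pos j hnz
    have h3 := Int.emod_add_mul_ediv j n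
    constructor <;> linarith
  have div_iff : ∀ j i : ℤ, j / n = i ↔ n * i ≤ j ∧ j < n * i + n := by
    intro j i
    constructor
    · rintro rfl
      have := mod_n j
      constructor <;> linarith
    · rintro ⟨h1, h2⟩
      have := mod_n j
      have a1 : j / n < i + 1 := by nlinarith
      have a2 : i < j / n + 1 := by nlinarith
      omega
  have hψL := shift_lip m hm0 (fun j => j / n) (3 * m) (by
      intro j
      have h1 := mod_n j
      have h2 := mod_n (j + 1)
      have a1 : (j + 1) / n < j / n + 2 := by nlinarith
      have a2 : j / n < (j + 1) / n + 1 := by nlinarith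
      omega) (by
      intro j
      have h1 := mod_m j
      have h2 := mod_n j
      have h3 := mod_n (j / m)
      have a1 : (m : ℤ) * (j / m / n) - j / n < m + 1 := by
        by_contra hc
        push Not at hc
        nlinarith
      have a2 : -(2 * m : ℤ) < (m : ℤ) * (j / m / n) - j / n := by
        by_contra hc
        push Not at hc
        nlinarith
      omega)
  have hφL := shift_lip m hm0 (fun j => n * j) (m + n * m) (by
      intro j
      have : (n : ℤ) * (j + 1) - n * j = n := by ring
      simp only [this]
      simp only [Int.natAbs_natCast]
      nlinarith) (by
      intro j
      have h1 := mod_m j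
      have e : j - m * (j / m) + (m * (n * (j / m)) - n * j)
        = (j - m * (j / m)) + -(n * (j - m * (j / m))) := by ring
      simp only [e]
      refine (Int.natAbs_add_le _ _).trans (add_le_add (by omega) ?_)
      rw [Int.natAbs_neg, Int.natAbs_mul]
      exact Nat.mul_le_mul (by simp) (by omega))
  have hclose : ∀ g, wordLength (gens m) (g⁻¹ * φ (ψ g)) ≤ n := by
    intro g
    have e : g⁻¹ * φ (ψ g) = B m ^ (-(J m hm0 g - n * (J m hm0 g / n))) := by
      rw [hφ, shift, hψ, J_shift, shift, mul_assoc, inv_mul_cancel_left, ← zpow_add]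
      congr 1
      ring
    rw [e]
    refine (wl_zpow hcl hb _).trans ?_
    have := mod_n (J m hm0 g)
    omega
  have hfib : ∀ y : BS m, ψ ⁻¹' {y} =
      (fun t : ℤ => y * B m ^ (t - J m hm0 y)) ''
        (Finset.Ico (n * J m hm0 y) (n * J m hm0 y + n) : Finset ℤ) := by
    intro y
    ext g
    simp only [Set.mem_preimage, Set.mem_singleton_iff, Set.mem_image, Finset.coe_Ico, Set.mem_Ico]
    constructor
    · rintro rfl
      have hJ : J m hm0 (ψ g) = J m hm0 g / n := J_shift _ _ _ _
      refine ⟨J m hm0 g, ?_, ?_⟩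
      · exact (div_iff _ _).1 hJ.symm
      · rw [hJ, hψ, shift, mul_assoc, ← zpow_add]
        simp
    · rintro ⟨t, ht, rfl⟩
      have h1 := (div_iff _ _).2 ht
      rw [hψ, shift, J_B_zpow]
      simp only [add_sub_cancel, h1]
      rw [mul_assoc, ← zpow_add]
      simp
  have hcard : ∀ y : BS m, (ψ ⁻¹' {y}).ncard = n := by
    intro y
    rw [hfib, Set.ncard_image_of_injective, Set.ncard_coe_finset]
    · simp
    · intro s t hst
      have := congrArg (J m hm0) hst
      simp only [J_B_zpow] at this
      linarith
  refine ⟨ψ, ⟨(3 * m + 1) + (m + n * m + 1), 2 * n, ?_, by positivity, ?_, ?_⟩, hcard⟩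
  · have : (0 : ℝ) ≤ m := by positivity
    have : (0 : ℝ) ≤ n * m := by positivity
    linarith
  · intro x y
    have h1 := hψL x y
    have h2 := hφL (ψ x) (ψ y)
    have h3 := hclose x
    have h4 := (wl_inv_le hcl _).trans (hclose y)
    have h5 : wordLength (gens m) (x⁻¹ * y) ≤ n + (m + n * m + 1) *
        wordLength (gens m) ((ψ x)⁻¹ * ψ y) + n := by
      have e : x⁻¹ * y = (x⁻¹ * φ (ψ x)) * ((φ (ψ x))⁻¹ * φ (ψ y)) * (y⁻¹ * φ (ψ y))⁻¹ := by
        group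
      rw [e]
      exact (wl_mul hcl _ _).trans (add_le_add ((wl_mul hcl _ _).trans (add_le_add h3 h2)) h4)
    have h1' : (wordLength (gens m) ((ψ x)⁻¹ * ψ y) : ℝ) ≤
      (3 * m + 1) * wordLength (gens m) (x⁻¹ * y) := by exact_mod_cast h1
    have h5' : (wordLength (gens m) (x⁻¹ * y) : ℝ) ≤ n + (m + n * m + 1) *
        wordLength (gens m) ((ψ x)⁻¹ * ψ y) + n := by exact_mod_cast h5
    change -(2 * n : ℝ) + (wordLength (gens m) (x⁻¹ * y) : ℝ) / _ ≤
      (wordLength (gens m) ((ψ x)⁻¹ * ψ y) : ℝ) ∧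
      (wordLength (gens m) ((ψ x)⁻¹ * ψ y) : ℝ) ≤
        _ * (wordLength (gens m) (x⁻¹ * y) : ℝ) + _
    generalize (wordLength (gens m) ((ψ x)⁻¹ * ψ y)) = p at *
    generalize (wordLength (gens m) (x⁻¹ * y)) = q at *
    have hp : (0 : ℝ) ≤ p := by positivity
    have hq : (0 : ℝ) ≤ q := by positivity
    have hm' : (0 : ℝ) ≤ m := by positivity
    have hn' : (0 : ℝ) ≤ n := by positivity
    have hnm : (0 : ℝ) ≤ n * m := by positivity
    constructor
    · rw [neg_add_le_iff_le_add, div_le_iff₀ (by positivity)]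
      have k1 : (0 : ℝ) ≤ n * (n * m) := by positivity
      have k2 : (0 : ℝ) ≤ m * p := by positivity
      have k3 : (0 : ℝ) ≤ n * m * p := by positivity
      nlinarith
    · have k2 : (0 : ℝ) ≤ (m + n * m + 1) * q := by positivity
      nlinarith
  · intro y
    have hne : (ψ ⁻¹' {y}).Nonempty := by
      apply Set.nonempty_of_ncard_ne_zero
      rw [hcard]; omega
    obtain ⟨x, hx⟩ := hne
    have hx : ψ x = y := hx
    refine ⟨x, ?_⟩
    rw [hx, wordDist, inv_mul_cancel, wl_one]
    push_cast
    positivity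
end

section
/- Let G be a finitely generated amenable group with the word metric and let H be a proper subgroup of finite index n > 1. Then for every Folner sequence {S_i} of G there exist elements g_i ∈ G such that the translates F_i = g_i⁻¹ S_i form a Folner sequence for G satisfying |F_i \ H| ≥ ((n−1)/n)·|F_i| for every i; in particular |F_i \ H|/|∂F_i| → ∞. -/
open Filter

theorem setDist_translate {G : Type*} [Group G] (S : Set G) (g x : G) (A : Set G) :
    setDist S x ((fun y => g⁻¹ * y) '' A) = setDist S (g * x) A := by
  unfold setDist wordDist
  rw [Set.image_image]
  simp [mul_assoc]

theorem wordBoundary_translate {G : Type*} [Group G] (S : Set G) (g : G) (A : Set G) :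
    (wordBoundary S ((fun y => g⁻¹ * y) '' A)).ncard = (wordBoundary S A).ncard := by
  have h : wordBoundary S ((fun y => g⁻¹ * y) '' A)
      = (fun y => g⁻¹ * y) '' (wordBoundary S A) := by
    ext x
    simp only [wordBoundary, Set.mem_setOf_eq, setDist_translate, Set.mem_image]
    constructor
    · intro hx
      exact ⟨g * x, hx, by simp⟩
    · rintro ⟨y, hy, rfl⟩
      simpa using hy
  rw [h]
  exact Set.ncard_image_of_injective _ (mul_right_injective g⁻¹)

theorem exists_translate {G : Type*} [Group G] [DecidableEq G] (H : Subgroup G) (n : ℕ)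
    (hn : 1 < n) (hindex : H.index = n) (F : Finset G) :
    ∃ g : G, ((n : ℝ) - 1) / n * (F.card : ℝ)
      ≤ ((((F.image (fun x => g⁻¹ * x) : Finset G) : Set G) \ (H : Set G)).ncard : ℝ) := by
  classical
  haveI : H.FiniteIndex := ⟨by omega⟩
  haveI : Fintype (G ⧸ H) := Fintype.ofFinite _
  have hcard : Fintype.card (G ⧸ H) = n := by
    rw [← hindex, Subgroup.index, Nat.card_eq_fintype_card]
  have hsum : F.card = ∑ q : G ⧸ H, (F.filter (fun x : G => (x : G ⧸ H) = q)).card :=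
    Finset.card_eq_sum_card_fiberwise (fun x _ => Finset.mem_coe.2 (Finset.mem_univ _))
  obtain ⟨q, hq⟩ : ∃ q : G ⧸ H, n * (F.filter (fun x : G => (x : G ⧸ H) = q)).card ≤ F.card := by
    by_contra! hcon
    have h1 : ∑ q : G ⧸ H, F.card
        < ∑ q : G ⧸ H, n * (F.filter (fun x : G => (x : G ⧸ H) = q)).card :=
      Finset.sum_lt_sum_of_nonempty ⟨((1 : G) : G ⧸ H), Finset.mem_univ _⟩ (fun q _ => hcon q)
    rw [← Finset.mul_sum, ← hsum] at h1
    simp [hcard] at h1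
  obtain ⟨g, rfl⟩ := QuotientGroup.mk_surjective q
  refine ⟨g, ?_⟩
  have hset : ((F.image (fun x => g⁻¹ * x) : Finset G) : Set G) \ (H : Set G)
      = (fun x => g⁻¹ * x) '' ((F.filter (fun x : G => ¬ (x : G ⧸ H) = (g : G ⧸ H)) : Finset G) : Set G) := by
    ext x
    simp only [Finset.coe_image, Set.mem_diff, Set.mem_image, Finset.mem_coe, Finset.mem_filter,
      SetLike.mem_coe]
    constructor
    · rintro ⟨⟨y, hy, rfl⟩, hx⟩
      exact ⟨y, ⟨hy, fun h => hx (QuotientGroup.eq.1 h.symm)⟩, rfl⟩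
    · rintro ⟨y, ⟨hy, hx⟩, rfl⟩
      exact ⟨⟨y, hy, rfl⟩, fun h => hx (QuotientGroup.eq.2 h).symm⟩
  rw [hset, Set.ncard_image_of_injective _ (mul_right_injective g⁻¹), Set.ncard_coe_finset]
  have hsplit := Finset.card_filter_add_card_filter_not (s := F)
    (fun x : G => (x : G ⧸ H) = (g : G ⧸ H))
  have hn0 : (0 : ℝ) < n := by exact_mod_cast (by omega : 0 < n)
  have hq' : (n : ℝ) * ((F.filter (fun x : G => (x : G ⧸ H) = (g : G ⧸ H))).card : ℝ) ≤ F.card := by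
    exact_mod_cast hq
  have hs' : ((F.filter (fun x : G => (x : G ⧸ H) = (g : G ⧸ H))).card : ℝ)
      + ((F.filter (fun x : G => ¬ (x : G ⧸ H) = (g : G ⧸ H))).card : ℝ) = F.card := by
    exact_mod_cast hsplit
  rw [div_mul_eq_mul_div, div_le_iff₀ hn0]
  rw [← hs'] at hq' ⊢
  nlinarith

/-- Let `G` be a finitely generated amenable group (word metric from a finite
generating set `S`) and `H` a proper subgroup of finite index `n > 1`. For every Folner
sequence `F` of `G` there are elements `g i ∈ G` such that the translates
`F' i = (g i)⁻¹ • F i` form a Folner sequence with `|F' i \ H| ≥ ((n-1)/n)|F' i|` for all `i`;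
in particular `|F' i \ H| / |∂(F' i)| → ∞`, i.e. for every `C` eventually
`C·|∂(F' i)| ≤ |F' i \ H|`. -/
theorem folner_translates_mostly_outside_subgroup
    {G : Type*} [Group G] [DecidableEq G] (S : Set G) (hSfin : S.Finite)
    (hSgen : Subgroup.closure S = ⊤)
    (H : Subgroup G) (hproper : H ≠ ⊤) (n : ℕ) (hn : 1 < n) (hindex : H.index = n)
    (F : ℕ → Finset G) (hF : IsFolner S F) :
    ∃ g : ℕ → G,
      IsFolner S (fun i => (F i).image (fun x => (g i)⁻¹ * x)) ∧
      (∀ i, ((n : ℝ) - 1) / n * (((F i).image (fun x => (g i)⁻¹ * x)).card : ℝ)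
          ≤ (((((F i).image (fun x => (g i)⁻¹ * x)) : Set G) \ (H : Set G)).ncard : ℝ)) ∧
      (∀ C : ℝ, ∀ᶠ i in Filter.atTop,
        C * ((wordBoundary S ((((F i).image (fun x => (g i)⁻¹ * x)) : Set G))).ncard : ℝ)
          ≤ (((((F i).image (fun x => (g i)⁻¹ * x)) : Set G) \ (H : Set G)).ncard : ℝ)) := by
  choose g hg using fun i => exists_translate H n hn hindex (F i)
  have hc : ∀ i, ((F i).image (fun x => (g i)⁻¹ * x)).card = (F i).card := fun i =>
    Finset.card_image_of_injective _ (mul_right_injective (g i)⁻¹)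
  have hb : ∀ i, (wordBoundary S (((F i).image (fun x => (g i)⁻¹ * x) : Finset G) : Set G)).ncard
      = (wordBoundary S (F i : Set G)).ncard := fun i => by
    rw [Finset.coe_image, wordBoundary_translate]
  refine ⟨g, ⟨fun i => (hF.1 i).image _, ?_⟩, fun i => ?_, fun C => ?_⟩
  · simp only [hb, hc]
    exact hF.2
  · rw [hc]
    exact hg i
  · have hpos : (0 : ℝ) < 1 / (2 * (|C| + 1)) := by positivity
    filter_upwards [hF.2.eventually (gt_mem_nhds hpos)] with i hi
    rw [hb]
    refine le_trans ?_ (hg i)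
    have hFpos : (0 : ℝ) < (F i).card := by exact_mod_cast (hF.1 i).card_pos
    rw [div_lt_div_iff₀ hFpos (by positivity)] at hi
    have hn2 : (2 : ℝ) ≤ n := by exact_mod_cast hn
    have hhalf : (1 / 2 : ℝ) ≤ ((n : ℝ) - 1) / n := by
      rw [div_le_div_iff₀ (by norm_num) (by linarith)]
      linarith
    have h1 := mul_le_mul_of_nonneg_right hhalf hFpos.le
    have hb0 : (0 : ℝ) ≤ (wordBoundary S (F i : Set G)).ncard := Nat.cast_nonneg _
    have h2 := mul_le_mul_of_nonneg_right (le_abs_self C) hb0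
    nlinarith
end
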